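/- arXiv:2210.01074 — 2 statements merged into one kernel-verified Lean document; each statement's English description precedes it below -/
import Mathlib

section
/- Let 0 < a ≤ b. There exists a constant C = C(a,b) > 0 such that for every ε ∈ (0, 1/2] there exists a ReLU neural network D_ε : ℝ × ℝ → ℝ with depth(D_ε) ≤ C·log(ε^{−1})², width(D_ε) ≤ C and size(D_ε) ≤ C·log(ε^{−1})², satisfying sup_{x,y∈[a,b]} |D_ε(x,y) − x/y| ≤ ε. -/
open scoped BigOperators

/-- A ReLU neural network with input dimension `din` and output dimension `dout`:
a composition of `depth + 1` affine maps, with the componentwise ReLU activation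
applied after each of the first `depth` affine maps (i.e. `depth` hidden layers). -/
structure ReLUNet (din dout : ℕ) where
  depth : ℕ
  dims : ℕ → ℕ
  dims_in : dims 0 = din
  dims_out : dims (depth + 1) = dout
  W : (ℓ : ℕ) → Matrix (Fin (dims (ℓ + 1))) (Fin (dims ℓ)) ℝ
  b : (ℓ : ℕ) → Fin (dims (ℓ + 1)) → ℝ

namespace ReLUNet

variable {din dout : ℕ}

/-- The activations after `ℓ` hidden layers. -/
noncomputable def hidden (Φ : ReLUNet din dout) : (ℓ : ℕ) → (Fin din → ℝ) → Fin (Φ.dims ℓ) → ℝ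
  | 0, x, i => x (finCongr Φ.dims_in i)
  | ℓ + 1, x, i => max ((Φ.W ℓ).mulVec (Φ.hidden ℓ x) i + Φ.b ℓ i) 0

/-- Evaluation of a ReLU network: final affine layer applied to the last hidden activations. -/
noncomputable def eval (Φ : ReLUNet din dout) (x : Fin din → ℝ) : Fin dout → ℝ := fun i =>
  (Φ.W Φ.depth).mulVec (Φ.hidden Φ.depth x) (finCongr Φ.dims_out.symm i) +
    Φ.b Φ.depth (finCongr Φ.dims_out.symm i)

/-- The width: maximal dimension of a hidden layer. -/
def width (Φ : ReLUNet din dout) : ℕ := (Finset.Icc 1 Φ.depth).sup Φ.dims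

/-- The size: total number of entries of all weight matrices and bias vectors. -/
def size (Φ : ReLUNet din dout) : ℕ :=
  ∑ ℓ ∈ Finset.range (Φ.depth + 1), (Φ.dims (ℓ + 1) * Φ.dims ℓ + Φ.dims (ℓ + 1))

/-- Scalar evaluation for networks with one-dimensional output. -/
noncomputable def evalS (Φ : ReLUNet din 1) (x : Fin din → ℝ) : ℝ := Φ.eval x 0

/-- Scalar evaluation for scalar-to-scalar networks. -/
noncomputable def eval1 (Φ : ReLUNet 1 1) (x : ℝ) : ℝ := Φ.eval (fun _ => x) 0

/-- Scalar evaluation for two-input networks. -/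
noncomputable def eval2 (Φ : ReLUNet 2 1) (x y : ℝ) : ℝ := Φ.eval ![x, y] 0

end ReLUNet

namespace ReLUNet

open Matrix

/-- The parameters of a ReLU layer that maps `ℝ^N` to itself. -/
abbrev Layer (N : ℕ) := Matrix (Fin N) (Fin N) ℝ × (Fin N → ℝ)

/-- The map computed by a layer, including the activation. -/
noncomputable def Layer.apply {N : ℕ} (l : Layer N) (v : Fin N → ℝ) : Fin N → ℝ :=
  fun i => max ((l.1 *ᵥ v) i + l.2 i) 0

/-- The map computed by a list of layers, the head of the list acting first. -/
noncomputable def runLayers {N : ℕ} (L : List (Layer N)) (v : Fin N → ℝ) : Fin N → ℝ :=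
  L.foldl (fun v l => l.apply v) v

/-- The vector `x` followed by zeros. -/
def zeroPad {d : ℕ} (N : ℕ) (x : Fin d → ℝ) : Fin N → ℝ :=
  fun i => if h : i.val < d then x ⟨i, h⟩ else 0

lemma sum_castLE {d N : ℕ} (h : d ≤ N) (f : Fin N → ℝ) (hf : ∀ j : Fin N, d ≤ j.val → f j = 0) :
    ∑ j : Fin d, f (Fin.castLE h j) = ∑ j, f j := by
  obtain ⟨k, rfl⟩ := Nat.exists_eq_add_of_le h
  rw [Fin.sum_univ_add, Finset.sum_eq_zero (s := Finset.univ) (f := fun i => f (Fin.natAdd d i)),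
    add_zero]
  · rfl
  · intro i _
    exact hf _ (by simp)

/-- The network with input dimension `din ≤ N`, hidden layers `L` (all of width `N`), and a scalar
affine output layer. -/
noncomputable def ofLayers {din N : ℕ} (hd : din ≤ N) (hN : 1 ≤ N) (L : List (Layer N))
    (w : Fin N → ℝ) (c : ℝ) : ReLUNet din 1 :=
  let dims : ℕ → ℕ := fun ℓ => if ℓ = 0 then din else if ℓ ≤ L.length then N else 1
  have hdims : ∀ ℓ, dims ℓ ≤ N := fun ℓ => by dsimp only [dims]; split_ifs <;> omega
  { depth := L.length
    dims := dims
    dims_in := by simp [dims]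
    dims_out := by simp [dims]
    W := fun ℓ i j =>
      if h : ℓ < L.length then (L[ℓ]).1 (Fin.castLE (hdims _) i) (Fin.castLE (hdims _) j)
      else w (Fin.castLE (hdims _) j)
    b := fun ℓ i => if h : ℓ < L.length then (L[ℓ]).2 (Fin.castLE (hdims _) i) else c }

section ofLayers

variable {din N : ℕ} (hd : din ≤ N) (hN : 1 ≤ N) (L : List (Layer N)) (w : Fin N → ℝ) (c : ℝ)

@[simp] lemma ofLayers_depth : (ofLayers hd hN L w c).depth = L.length := rfl

lemma ofLayers_dims (ℓ : ℕ) : (ofLayers hd hN L w c).dims ℓ =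
    if ℓ = 0 then din else if ℓ ≤ L.length then N else 1 := rfl

lemma ofLayers_dims_le (ℓ : ℕ) : (ofLayers hd hN L w c).dims ℓ ≤ N := by
  rw [ofLayers_dims]; split_ifs <;> omega

lemma ofLayers_width_le : (ofLayers hd hN L w c).width ≤ N :=
  Finset.sup_le fun ℓ _ => ofLayers_dims_le hd hN L w c ℓ

lemma ofLayers_size_le : (ofLayers hd hN L w c).size ≤ (L.length + 1) * (N * N + N) := by
  unfold size
  refine (Finset.sum_le_card_nsmul _ _ (N * N + N) fun ℓ _ => ?_).trans (by simp)
  have h := ofLayers_dims_le hd hN L w c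
  exact add_le_add (Nat.mul_le_mul (h _) (h _)) (h _)

lemma ofLayers_sum_eq (x : Fin din → ℝ) {ℓ : ℕ} (hℓ : ℓ ≤ L.length) (u : Fin N → ℝ) :
    ∑ j : Fin ((ofLayers hd hN L w c).dims ℓ),
      u (Fin.castLE (ofLayers_dims_le hd hN L w c ℓ) j) *
        runLayers (L.take ℓ) (zeroPad N x) (Fin.castLE (ofLayers_dims_le hd hN L w c ℓ) j) =
      u ⬝ᵥ runLayers (L.take ℓ) (zeroPad N x) := by
  rw [dotProduct, sum_castLE (ofLayers_dims_le hd hN L w c ℓ)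
    fun j => u j * runLayers (L.take ℓ) (zeroPad N x) j]
  intro j hj
  rw [ofLayers_dims] at hj
  rcases Nat.eq_zero_or_pos ℓ with rfl | hpos
  · have : ¬ j.val < din := by simpa using hj
    simp [runLayers, zeroPad, this]
  · rw [if_neg hpos.ne', if_pos hℓ] at hj
    omega

lemma ofLayers_hidden (x : Fin din → ℝ) (ℓ : ℕ) (hℓ : ℓ ≤ L.length)
    (i : Fin ((ofLayers hd hN L w c).dims ℓ)) :
    (ofLayers hd hN L w c).hidden ℓ x i =
      runLayers (L.take ℓ) (zeroPad N x) (Fin.castLE (ofLayers_dims_le hd hN L w c ℓ) i) := by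
  induction ℓ with
  | zero =>
    have hi : i.val < din := i.isLt
    simp only [hidden, List.take_zero, runLayers, List.foldl_nil, zeroPad, Fin.val_castLE, hi,
      dif_pos]
    rfl
  | succ ℓ ih =>
    have hlt : ℓ < L.length := hℓ
    have hsum := ofLayers_sum_eq hd hN L w c x hlt.le
      ((L[ℓ]).1 (Fin.castLE (ofLayers_dims_le hd hN L w c _) i))
    have hrun : runLayers (L.take (ℓ + 1)) (zeroPad N x) =
        (L[ℓ]).apply (runLayers (L.take ℓ) (zeroPad N x)) := by
      rw [List.take_succ_eq_append_getElem hlt, runLayers, List.foldl_append]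
      rfl
    rw [hrun, Layer.apply, Matrix.mulVec, ← hsum, hidden, Matrix.mulVec, dotProduct]
    congr 2
    · refine Finset.sum_congr rfl fun j _ => ?_
      rw [ih hlt.le j]
      simp [ofLayers, hlt]
    · simp [ofLayers, hlt]

lemma ofLayers_eval (x : Fin din → ℝ) :
    (ofLayers hd hN L w c).eval x 0 = w ⬝ᵥ runLayers L (zeroPad N x) + c := by
  have hsum := ofLayers_sum_eq hd hN L w c x le_rfl w
  rw [List.take_length] at hsum
  rw [eval, ← hsum, Matrix.mulVec, dotProduct]
  congr 1
  · refine Finset.sum_congr rfl fun j _ => ?_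
    have hj := ofLayers_hidden hd hN L w c x L.length le_rfl j
    rw [List.take_length] at hj
    exact congrArg₂ (· * ·) (by simp [ofLayers]) hj
  · simp [ofLayers]

end ofLayers

/-! ### The tent map -/

/-- The tent map on `[0, 1]`, in the form computed by two ReLU units. -/
noncomputable def tent (p : ℝ) : ℝ := 2 * p - 4 * max (p - 1 / 2) 0

lemma tent_mem {p : ℝ} (hp : p ∈ Set.Icc (0 : ℝ) 1) : tent p ∈ Set.Icc (0 : ℝ) 1 := by
  obtain ⟨h0, h1⟩ := hp
  unfold tent
  rcases max_cases (p - 1 / 2) 0 with ⟨h, _⟩ | ⟨h, _⟩ <;> rw [h] <;> constructor <;> linarith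

lemma mul_one_sub_eq_tent (p : ℝ) : p * (1 - p) = (tent p + tent p * (1 - tent p)) / 4 := by
  unfold tent
  rcases max_cases (p - 1 / 2) 0 with ⟨h, _⟩ | ⟨h, _⟩ <;> rw [h] <;> ring

lemma mul_one_sub_mem {p : ℝ} (hp : p ∈ Set.Icc (0 : ℝ) 1) :
    p * (1 - p) ∈ Set.Icc (0 : ℝ) (1 / 4) :=
  ⟨mul_nonneg hp.1 (by linarith [hp.2]), by nlinarith [sq_nonneg (p - 1 / 2)]⟩

/-! ### Approximate multiplication and the iteration `s ↦ t + z * s`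

The hidden state is `(z, t, p, (p - 1/2)⁺, q, (q - 1/2)⁺, R)`; between two rounds the entry with
index `2` holds the current iterate `s`. -/

/-- Computes `z = 1 - y / b` and `t = κ * x` from the input. -/
noncomputable def initLayer (b κ : ℝ) : Layer 7 :=
  (!![0, -b⁻¹, 0, 0, 0, 0, 0;
      κ, 0, 0, 0, 0, 0, 0;
      0, 0, 0, 0, 0, 0, 0;
      0, 0, 0, 0, 0, 0, 0;
      0, 0, 0, 0, 0, 0, 0;
      0, 0, 0, 0, 0, 0, 0;
      0, 0, 0, 0, 0, 0, 0], ![1, 0, 0, 0, 0, 0, 0])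

/-- Starts the approximation of `z * s`, with `p = (z + s) / 2` and `q = (1 + z - s) / 2`. -/
noncomputable def splitLayer : Layer 7 :=
  (!![1, 0, 0, 0, 0, 0, 0;
      0, 1, 0, 0, 0, 0, 0;
      1/2, 0, 1/2, 0, 0, 0, 0;
      1/2, 0, 1/2, 0, 0, 0, 0;
      1/2, 0, -1/2, 0, 0, 0, 0;
      1/2, 0, -1/2, 0, 0, 0, 0;
      1/2, 0, 1/2, 0, 0, 0, 0], ![0, 0, 0, -1/2, 1/2, 0, 3/4])

/-- Applies the tent map to `p` and `q` and adds `γ * (tent q - tent p)` to `R`. -/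
noncomputable def tentLayer (γ : ℝ) : Layer 7 :=
  (!![1, 0, 0, 0, 0, 0, 0;
      0, 1, 0, 0, 0, 0, 0;
      0, 0, 2, -4, 0, 0, 0;
      0, 0, 2, -4, 0, 0, 0;
      0, 0, 0, 0, 2, -4, 0;
      0, 0, 0, 0, 2, -4, 0;
      0, 0, -2 * γ, 4 * γ, 2 * γ, -4 * γ, 1], ![0, 0, 0, -1/2, 0, -1/2, 0])

/-- Replaces the iterate by `t + R - 1`. -/
noncomputable def mergeLayer : Layer 7 :=
  (!![1, 0, 0, 0, 0, 0, 0;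
      0, 1, 0, 0, 0, 0, 0;
      0, 1, 0, 0, 0, 0, 1;
      0, 0, 0, 0, 0, 0, 0;
      0, 0, 0, 0, 0, 0, 0;
      0, 0, 0, 0, 0, 0, 0;
      0, 0, 0, 0, 0, 0, 0], ![0, 0, -1, 0, 0, 0, 0])

/-- The hidden state while `z * s` is being approximated. -/
noncomputable def tentState (z t p q R : ℝ) : Fin 7 → ℝ :=
  ![z, t, p, max (p - 1 / 2) 0, q, max (q - 1 / 2) 0, R]

lemma initLayer_apply {b κ x y : ℝ} (hz : 0 ≤ 1 - y / b) (ht : 0 ≤ κ * x) :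
    (initLayer b κ).apply (zeroPad 7 ![x, y]) = ![1 - y / b, κ * x, 0, 0, 0, 0, 0] := by
  have hz' : 0 ≤ -(b⁻¹ * y) + 1 := by rw [div_eq_inv_mul] at hz; linarith
  ext i
  fin_cases i <;>
    simp [Layer.apply, initLayer, zeroPad, Matrix.mulVec, dotProduct, Fin.sum_univ_succ, ht, hz']
  ring

lemma splitLayer_apply {z t s : ℝ} (hz : z ∈ Set.Icc (0 : ℝ) 1) (ht : 0 ≤ t)
    (hs : s ∈ Set.Icc (0 : ℝ) 1) :
    splitLayer.apply ![z, t, s, 0, 0, 0, 0] =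
      tentState z t ((z + s) / 2) ((1 + z - s) / 2) ((z + s) / 2 + 3 / 4) := by
  obtain ⟨hz0, hz1⟩ := hz
  obtain ⟨hs0, hs1⟩ := hs
  ext i
  fin_cases i <;>
    simp [Layer.apply, splitLayer, tentState, Matrix.mulVec, dotProduct, Fin.sum_univ_succ, ht,
      hz0] <;> ring_nf
  all_goals exact max_eq_left (by linarith)

lemma tentLayer_apply {z t p q R γ : ℝ} (hz : 0 ≤ z) (ht : 0 ≤ t)
    (hp : p ∈ Set.Icc (0 : ℝ) 1) (hq : q ∈ Set.Icc (0 : ℝ) 1)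
    (hR : 0 ≤ R + γ * (tent q - tent p)) :
    (tentLayer γ).apply (tentState z t p q R) =
      tentState z t (tent p) (tent q) (R + γ * (tent q - tent p)) := by
  have hp0 := (tent_mem hp).1
  have hq0 := (tent_mem hq).1
  have key : (tentLayer γ).apply (tentState z t p q R) =
      ![max z 0, max t 0, max (tent p) 0, max (tent p - 1 / 2) 0, max (tent q) 0,
        max (tent q - 1 / 2) 0, max (R + γ * (tent q - tent p)) 0] := by
    ext i
    fin_cases i <;>
      simp [Layer.apply, tentLayer, tentState, tent, Matrix.mulVec, dotProduct,
        Fin.sum_univ_succ] <;> ring_nf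
  rw [key, max_eq_left hz, max_eq_left ht, max_eq_left hp0, max_eq_left hq0, max_eq_left hR,
    tentState]

lemma mergeLayer_apply {z t p q R : ℝ} (hz : 0 ≤ z) (ht : 0 ≤ t) :
    mergeLayer.apply (tentState z t p q R) = ![z, t, max (t + R - 1) 0, 0, 0, 0, 0] := by
  ext i
  fin_cases i <;>
    simp [Layer.apply, mergeLayer, tentState, Matrix.mulVec, dotProduct, Fin.sum_univ_succ, hz,
      ht]
  ring_nf

/-- `m` successive tent layers. -/
noncomputable def tentLayers (m : ℕ) : List (Layer 7) :=
  (List.range m).map fun k => tentLayer ((1 / 4) ^ (k + 1))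

lemma runLayers_tentLayers {z t u p q : ℝ} (hz : 0 ≤ z) (ht : 0 ≤ t) (hu : 0 ≤ u)
    (hp : p ∈ Set.Icc (0 : ℝ) 1) (hq : q ∈ Set.Icc (0 : ℝ) 1) (m : ℕ) :
    ∃ p' ∈ Set.Icc (0 : ℝ) 1, ∃ q' ∈ Set.Icc (0 : ℝ) 1,
      runLayers (tentLayers m) (tentState z t p q (1 + u + (p * (1 - p) - q * (1 - q)))) =
        tentState z t p' q' (1 + u + (1 / 4) ^ m * (p' * (1 - p') - q' * (1 - q'))) := by
  induction m with
  | zero => exact ⟨p, hp, q, hq, by simp [runLayers, tentLayers]⟩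
  | succ m ih =>
    obtain ⟨p', hp', q', hq', ih⟩ := ih
    have hR : 1 + u + (1 / 4 : ℝ) ^ m * (p' * (1 - p') - q' * (1 - q')) +
        (1 / 4) ^ (m + 1) * (tent q' - tent p') =
        1 + u + (1 / 4) ^ (m + 1) *
          (tent p' * (1 - tent p') - tent q' * (1 - tent q')) := by
      rw [mul_one_sub_eq_tent p', mul_one_sub_eq_tent q']
      ring
    refine ⟨tent p', tent_mem hp', tent q', tent_mem hq', ?_⟩
    have hrun : ∀ v, runLayers (tentLayers (m + 1)) v =
        (tentLayer ((1 / 4) ^ (m + 1))).apply (runLayers (tentLayers m) v) := fun v => by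
      simp [runLayers, tentLayers, List.range_succ]
    rw [hrun, ih, tentLayer_apply hz ht hp' hq', hR]
    rw [hR]
    have h1 := mul_one_sub_mem (tent_mem hp')
    have h2 := mul_one_sub_mem (tent_mem hq')
    have h3 : (1 / 4 : ℝ) ^ (m + 1) ≤ 1 := pow_le_one₀ (by norm_num) (by norm_num)
    have h4 : (0 : ℝ) ≤ (1 / 4) ^ (m + 1) := by positivity
    nlinarith [h1.1, h2.2]

/-- One round of the iteration `s ↦ t + z * s`, up to an error of order `4⁻ᵐ`. -/
noncomputable def roundLayers (m : ℕ) : List (Layer 7) :=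
  splitLayer :: (tentLayers m ++ [mergeLayer])

lemma runLayers_roundLayers {z t s : ℝ} (hz : z ∈ Set.Icc (0 : ℝ) 1) (ht : 0 ≤ t)
    (hs : s ∈ Set.Icc (0 : ℝ) 1) (m : ℕ) :
    ∃ e : ℝ, |e| ≤ (1 / 4) ^ m ∧
      runLayers (roundLayers m) ![z, t, s, 0, 0, 0, 0] =
        ![z, t, max (t + z * s + e) 0, 0, 0, 0, 0] := by
  have hp : (z + s) / 2 ∈ Set.Icc (0 : ℝ) 1 := ⟨by linarith [hz.1, hs.1], by linarith [hz.2, hs.2]⟩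
  have hq : (1 + z - s) / 2 ∈ Set.Icc (0 : ℝ) 1 :=
    ⟨by linarith [hz.1, hs.2], by linarith [hz.2, hs.1]⟩
  obtain ⟨p', hp', q', hq', h⟩ :=
    runLayers_tentLayers hz.1 ht (mul_nonneg hz.1 hs.1) hp hq m
  have h1 := mul_one_sub_mem hp'
  have h2 := mul_one_sub_mem hq'
  refine ⟨(1 / 4) ^ m * (p' * (1 - p') - q' * (1 - q')), ?_, ?_⟩
  · rw [abs_mul, abs_of_nonneg (by positivity : (0 : ℝ) ≤ (1 / 4) ^ m)]
    refine mul_le_of_le_one_right (by positivity) (abs_le.2 ⟨?_, ?_⟩) <;>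
      linarith [h1.1, h1.2, h2.1, h2.2]
  · have hR : (z + s) / 2 + 3 / 4 = 1 + z * s + ((z + s) / 2 * (1 - (z + s) / 2) -
        (1 + z - s) / 2 * (1 - (1 + z - s) / 2)) := by ring
    have hrun : ∀ v, runLayers (roundLayers m) v =
        mergeLayer.apply (runLayers (tentLayers m) (splitLayer.apply v)) := fun v => by
      simp [runLayers, roundLayers]
    rw [hrun, splitLayer_apply hz ht hs, hR, h, mergeLayer_apply hz.1 ht]
    congr 4
    ring

lemma runLayers_replicate_roundLayers {z t θ s₀ : ℝ} (hz : z ∈ Set.Icc (0 : ℝ) 1) (hzθ : z ≤ θ)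
    (hθ : θ < 1) (ht : 0 ≤ t) (hs₀ : s₀ ∈ Set.Icc (0 : ℝ) (1 / 2)) (hfix : s₀ = t + z * s₀)
    {m : ℕ} (hm : (1 / 4) ^ m / (1 - θ) ≤ (1 / 2 : ℝ)) (K : ℕ) :
    ∃ s ∈ Set.Icc (0 : ℝ) 1, |s - s₀| ≤ θ ^ K + (1 / 4) ^ m / (1 - θ) ∧
      runLayers (List.replicate K (roundLayers m)).flatten ![z, t, 0, 0, 0, 0, 0] =
        ![z, t, s, 0, 0, 0, 0] := by
  set η : ℝ := (1 / 4) ^ m / (1 - θ) with hη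
  have hθ0 : 0 ≤ θ := hz.1.trans hzθ
  have hη0 : 0 ≤ η := div_nonneg (by positivity) (by linarith)
  have hδ : (1 / 4 : ℝ) ^ m = η * (1 - θ) := by
    rw [hη, div_mul_cancel₀ _ (by linarith)]
  suffices H : ∃ s ∈ Set.Icc (0 : ℝ) 1, |s - s₀| ≤ 1 / 2 ∧ |s - s₀| ≤ θ ^ K + η ∧
      runLayers (List.replicate K (roundLayers m)).flatten ![z, t, 0, 0, 0, 0, 0] =
        ![z, t, s, 0, 0, 0, 0] by
    obtain ⟨s, hs, _, h⟩ := H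
    exact ⟨s, hs, h⟩
  induction K with
  | zero =>
    have h : |0 - s₀| ≤ 1 / 2 := by
      rw [zero_sub, abs_neg, abs_of_nonneg hs₀.1]
      exact hs₀.2
    exact ⟨0, by simp, h, by rw [pow_zero]; linarith, by simp [runLayers]⟩
  | succ K ih =>
    obtain ⟨s, hs, hhalf, hs', hrun⟩ := ih
    obtain ⟨e, he, hround⟩ := runLayers_roundLayers hz ht hs m
    have hstep : |max (t + z * s + e) 0 - s₀| ≤ θ * |s - s₀| + η * (1 - θ) := by
      have h1 : |max (t + z * s + e) 0 - s₀| ≤ |t + z * s + e - s₀| := by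
        simpa [max_eq_left hs₀.1] using abs_max_sub_max_le_abs (t + z * s + e) s₀ 0
      have h2 : t + z * s + e - s₀ = z * (s - s₀) + e := by linear_combination -hfix
      have h3 : |z * (s - s₀)| ≤ θ * |s - s₀| := by
        rw [abs_mul, abs_of_nonneg hz.1]
        exact mul_le_mul_of_nonneg_right hzθ (abs_nonneg _)
      rw [h2] at h1
      linarith [abs_add_le (z * (s - s₀)) e]
    have hhalf' : |max (t + z * s + e) 0 - s₀| ≤ 1 / 2 := by nlinarith
    refine ⟨max (t + z * s + e) 0, ⟨le_max_right _ _, ?_⟩, hhalf', ?_, ?_⟩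
    · linarith [(abs_le.1 hhalf').2, hs₀.2]
    · rw [pow_succ]
      nlinarith
    · rw [List.replicate_succ', List.flatten_append, runLayers, List.foldl_append]
      simp only [List.flatten_cons, List.flatten_nil, List.append_nil]
      simp only [runLayers] at hrun hround
      rw [hrun, hround]

/-- `K` rounds of the iteration whose fixed point is proportional to `x / y`. -/
noncomputable def divLayers (b κ : ℝ) (m K : ℕ) : List (Layer 7) :=
  initLayer b κ :: (List.replicate K (roundLayers m)).flatten

lemma length_divLayers (b κ : ℝ) (m K : ℕ) :
    (divLayers b κ m K).length = K * (m + 2) + 1 := by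
  simp [divLayers, roundLayers, tentLayers]

/-- The network that rescales the iterate computed by `divLayers` to approximate `x / y`. -/
noncomputable def divNet (a b : ℝ) (m K : ℕ) : ReLUNet 2 1 :=
  ofLayers (by norm_num) (by norm_num) (divLayers b (a / (2 * b ^ 2)) m K)
    ![0, 0, 2 * b / a, 0, 0, 0, 0] 0

lemma abs_divNet_sub_le {a b : ℝ} (ha : 0 < a) (hab : a ≤ b) {m K : ℕ}
    (hm : (1 / 4) ^ m / (a / b) ≤ (1 / 2 : ℝ)) {x y : ℝ} (hx : x ∈ Set.Icc a b)
    (hy : y ∈ Set.Icc a b) :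
    |(divNet a b m K).eval2 x y - x / y| ≤
      2 * b / a * ((1 - a / b) ^ K + (1 / 4) ^ m / (a / b)) := by
  obtain ⟨hx1, hx2⟩ := hx
  obtain ⟨hy1, hy2⟩ := hy
  have hb : 0 < b := ha.trans_le hab
  have hx0 : 0 < x := ha.trans_le hx1
  have hy0 : 0 < y := ha.trans_le hy1
  have hz0 : 0 ≤ 1 - y / b := by rw [sub_nonneg, div_le_one hb]; exact hy2
  have hz1 : 1 - y / b ≤ 1 - a / b := by gcongr
  have hab0 : 0 < a / b := div_pos ha hb
  have ht : 0 ≤ a / (2 * b ^ 2) * x := by positivity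
  have hs₀ : a * x / (2 * b * y) ∈ Set.Icc (0 : ℝ) (1 / 2) := by
    refine ⟨by positivity, ?_⟩
    rw [div_le_div_iff₀ (by positivity) (by norm_num)]
    nlinarith [mul_le_mul hx2 hy1 ha.le hb.le]
  have hfix : a * x / (2 * b * y) = a / (2 * b ^ 2) * x + (1 - y / b) * (a * x / (2 * b * y)) := by
    field_simp
    ring
  obtain ⟨s, -, hs, hrun⟩ := runLayers_replicate_roundLayers (θ := 1 - a / b)
    ⟨hz0, by linarith⟩ hz1 (by linarith) ht hs₀ hfix (by rwa [sub_sub_cancel]) K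
  rw [sub_sub_cancel] at hs
  have heval : (divNet a b m K).eval2 x y = 2 * b / a * s := by
    have h : runLayers (divLayers b (a / (2 * b ^ 2)) m K) (zeroPad 7 ![x, y]) =
        ![1 - y / b, a / (2 * b ^ 2) * x, s, 0, 0, 0, 0] := by
      rw [← hrun, ← initLayer_apply hz0 ht]
      rfl
    rw [eval2, divNet, ofLayers_eval, h]
    simp [dotProduct, Fin.sum_univ_succ]
  have hdiff : 2 * b / a * s - x / y = 2 * b / a * (s - a * x / (2 * b * y)) := by
    field_simp
  rw [heval, hdiff, abs_mul, abs_of_pos (by positivity)]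
  gcongr

end ReLUNet

lemma exists_half_pow_le {ε : ℝ} (hε : 0 < ε) (hε2 : ε ≤ 1 / 2) :
    ∃ M : ℕ, 1 ≤ M ∧ (1 / 2 : ℝ) ^ M ≤ ε ∧ (M : ℝ) ≤ 4 * Real.log ε⁻¹ := by
  have hlog2 := Real.log_two_gt_d9
  have hL : Real.log 2 ≤ Real.log ε⁻¹ :=
    Real.log_le_log (by norm_num) (by rw [le_inv_comm₀ (by norm_num) hε]; linarith)
  refine ⟨⌈2 * Real.log ε⁻¹⌉₊, Nat.ceil_pos.2 (by linarith), ?_, ?_⟩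
  · rw [← Real.log_le_log_iff (by positivity) hε, Real.log_pow, one_div, Real.log_inv]
    have h := Nat.le_ceil (2 * Real.log ε⁻¹)
    rw [Real.log_inv] at *
    nlinarith
  · linarith [Nat.ceil_lt_add_one (show 0 ≤ 2 * Real.log ε⁻¹ by linarith)]

lemma exists_mul_pow_mul_le (A : ℝ) (hA : 1 ≤ A) {r : ℝ} (hr0 : 0 ≤ r) (hr1 : r < 1) :
    ∃ k : ℕ, ∀ M : ℕ, 1 ≤ M → A * r ^ (k * M) ≤ (1 / 2) ^ M := by
  have hA0 : 0 < A := by linarith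
  obtain ⟨k, hk⟩ := exists_pow_lt_of_lt_one (show 0 < 1 / (2 * A) by positivity) hr1
  refine ⟨k, fun M hM => ?_⟩
  have h1 : A * r ^ k ≤ 1 / 2 := by
    rw [lt_div_iff₀ (by positivity)] at hk
    linarith
  calc A * r ^ (k * M) ≤ A ^ M * (r ^ k) ^ M := by
        rw [pow_mul]
        gcongr
        exact le_self_pow₀ hA (by omega)
    _ = (A * r ^ k) ^ M := (mul_pow _ _ _).symm
    _ ≤ (1 / 2) ^ M := by gcongr

/-- **Proposition (Division).** Let $0 < a ≤ b$. There is $C = C(a,b) > 0$ such that for every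
$ε ∈ (0,1/2]$ there is a ReLU network $D_ε : ℝ² → ℝ$ of depth $≤ C \log(ε^{-1})^2$, width $≤ C$
and size $≤ C \log(ε^{-1})^2$ with $\sup_{x,y ∈ [a,b]} |D_ε(x,y) - x/y| ≤ ε$. -/
theorem relu_approx_division (a b : ℝ) (ha : 0 < a) (hab : a ≤ b) :
    ∃ C > (0 : ℝ), ∀ ε : ℝ, 0 < ε → ε ≤ 1 / 2 →
      ∃ D : ReLUNet 2 1,
        (D.depth : ℝ) ≤ C * Real.log ε⁻¹ ^ 2 ∧
        (D.width : ℝ) ≤ C ∧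
        (D.size : ℝ) ≤ C * Real.log ε⁻¹ ^ 2 ∧
        ∀ x ∈ Set.Icc a b, ∀ y ∈ Set.Icc a b, |D.eval2 x y - x / y| ≤ ε := by
  have hb : 0 < b := ha.trans_le hab
  have hab0 : 0 < a / b := div_pos ha hb
  have hab1 : a / b ≤ 1 := (div_le_one hb).2 hab
  have hba1 : 1 ≤ b / a := (one_le_div ha).2 hab
  obtain ⟨k, hk⟩ := exists_mul_pow_mul_le (2 * (2 * b / a))
    (by rw [mul_div_assoc]; linarith) (r := 1 - a / b) (by linarith) (by linarith)
  obtain ⟨n, hn⟩ := exists_mul_pow_mul_le (2 * (2 * b / a) / (a / b))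
    (by rw [le_div_iff₀ hab0, mul_div_assoc]; linarith) (r := 1 / 4) (by norm_num) (by norm_num)
  refine ⟨1792 * (k * (n + 2) + 1), by positivity, fun ε hε hε2 => ?_⟩
  obtain ⟨M, hM1, hMε, hMlog⟩ := exists_half_pow_le hε hε2
  have hM1' : (1 : ℝ) ≤ M := by exact_mod_cast hM1
  have hM2 : (M : ℝ) ^ 2 ≤ 16 * Real.log ε⁻¹ ^ 2 := by nlinarith
  have hlen : ((k * M : ℕ) * ((n * M : ℕ) + 2) + 1 : ℝ) ≤ (k * (n + 2) + 1) * M ^ 2 := by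
    have h1 : (M : ℝ) ≤ M ^ 2 := by nlinarith
    have h2 : (1 : ℝ) ≤ M ^ 2 := by nlinarith
    push_cast
    nlinarith [mul_le_mul_of_nonneg_left h1 (Nat.cast_nonneg (α := ℝ) k)]
  have hdepth : ((k * M : ℕ) * ((n * M : ℕ) + 2) + 1 : ℝ) ≤
      16 * (k * (n + 2) + 1) * Real.log ε⁻¹ ^ 2 := by
    have h : (0 : ℝ) ≤ k * (n + 2) + 1 := by positivity
    nlinarith [mul_le_mul_of_nonneg_left hM2 h]
  refine ⟨ReLUNet.divNet a b (n * M) (k * M), ?_, ?_, ?_, fun x hx y hy => ?_⟩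
  · rw [ReLUNet.divNet, ReLUNet.ofLayers_depth, ReLUNet.length_divLayers]
    push_cast at hdepth ⊢
    refine hdepth.trans ?_
    gcongr
    norm_num
  · have h : ((ReLUNet.divNet a b (n * M) (k * M)).width : ℝ) ≤ 7 := by
      exact_mod_cast ReLUNet.ofLayers_width_le _ _ _ _ _
    have h0 : (0 : ℝ) ≤ k * (n + 2) := by positivity
    linarith
  · have h : ((ReLUNet.divNet a b (n * M) (k * M)).size : ℝ) ≤
        ((k * M : ℕ) * ((n * M : ℕ) + 2) + 1 + 1) * (7 * 7 + 7) := by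
      have h := ReLUNet.ofLayers_size_le (din := 2) (by norm_num) (by norm_num)
        (ReLUNet.divLayers b (a / (2 * b ^ 2)) (n * M) (k * M)) ![0, 0, 2 * b / a, 0, 0, 0, 0] 0
      rw [ReLUNet.length_divLayers] at h
      exact_mod_cast h
    have h0 : (0 : ℝ) ≤ (k * M : ℕ) * ((n * M : ℕ) + 2) := by positivity
    linarith
  · have h1 := (hk M hM1).trans hMε
    have h2 := (hn M hM1).trans hMε
    have hm : 2 * (2 * b / a) * ((1 / 4) ^ (n * M) / (a / b)) ≤ ε := by
      rw [mul_div_assoc', ← div_mul_eq_mul_div]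
      exact h2
    have hη : (0 : ℝ) ≤ (1 / 4) ^ (n * M) / (a / b) := by positivity
    refine (ReLUNet.abs_divNet_sub_le ha hab ?_ hx hy).trans (by linarith)
    rw [mul_div_assoc] at hm
    nlinarith
end

section
/- For every t > 1 there exists a unique x_t ∈ (0,π) satisfying x_t = t·sin(x_t), and the map Ψ_t(x₀) = x₀ − t·sin(x₀) is a strictly increasing continuous bijection from the interval [x_t, 2π − x_t] onto [0, 2π]. -/
open Real

/-- `x cos x < sin x` on `(0, π)`. -/
lemma mul_cos_lt_sin {x : ℝ} (hx : x ∈ Set.Ioo 0 π) : x * cos x < sin x := by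
  obtain ⟨h0, hπ⟩ := hx
  have hs := sin_pos_of_pos_of_lt_pi h0 hπ
  rcases lt_or_ge x (π / 2) with h | h
  · have hc : 0 < cos x := cos_pos_of_mem_Ioo ⟨by linarith, h⟩
    have ht := lt_tan h0 h
    rwa [tan_eq_sin_div_cos, lt_div_iff₀ hc] at ht
  · have hc : cos x ≤ 0 := cos_nonpos_of_pi_div_two_le_of_le h (by linarith)
    nlinarith

/-- The cosine on an interval symmetric about `π` is largest at the end points. -/
lemma cos_le_cos_of_mem_Icc_two_pi_sub {a x : ℝ} (ha : 0 ≤ a)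
    (hx : x ∈ Set.Icc a (2 * π - a)) : cos x ≤ cos a := by
  rcases le_total x π with h | h
  · exact cos_le_cos_of_nonneg_of_le_pi ha h hx.1
  · rw [← cos_two_pi_sub x]
    exact cos_le_cos_of_nonneg_of_le_pi ha (by linarith) (by linarith [hx.2])

lemma strictMonoOn_sub_mul_sin {t a : ℝ} (ht : 0 < t) (ha : a ∈ Set.Ioo 0 π)
    (hfix : a = t * sin a) :
    StrictMonoOn (fun x : ℝ => x - t * sin x) (Set.Icc a (2 * π - a)) := by
  have hcos : t * cos a < 1 := by
    have h : t * (a * cos a) < t * sin a := mul_lt_mul_of_pos_left (mul_cos_lt_sin ha) ht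
    rw [← hfix] at h
    nlinarith [ha.1]
  refine strictMonoOn_of_deriv_pos (convex_Icc _ _) (by fun_prop) fun x hx => ?_
  have hd : HasDerivAt (fun x : ℝ => x - t * sin x) (1 - t * cos x) x :=
    (hasDerivAt_id x).sub ((hasDerivAt_sin x).const_mul t)
  rw [hd.deriv]
  have hle := cos_le_cos_of_mem_Icc_two_pi_sub ha.1.le (interior_subset hx)
  nlinarith

lemma exists_eq_mul_sin {t : ℝ} (ht : 1 < t) : ∃ x ∈ Set.Ioo 0 π, x = t * sin x := by
  have h0 : 0 < t := by linarith
  have hmem : t⁻¹ ∈ Set.Ioo (sinc π) (sinc 0) := by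
    rw [sinc_of_ne_zero pi_ne_zero, sin_pi, zero_div, sinc_zero]
    exact ⟨inv_pos.2 h0, inv_lt_one_of_one_lt₀ ht⟩
  obtain ⟨x, hx, h⟩ := intermediate_value_Ioo' pi_pos.le continuous_sinc.continuousOn hmem
  refine ⟨x, hx, ?_⟩
  have hx0 := hx.1.ne'
  rw [sinc_of_ne_zero hx0] at h
  field_simp at h
  linarith

lemma eq_of_eq_mul_sin {t x y : ℝ} (ht : 0 < t) (hx : x ∈ Set.Ioo 0 π) (hy : y ∈ Set.Ioo 0 π)
    (hfx : x = t * sin x) (hfy : y = t * sin y) : x = y := by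
  wlog hxy : x ≤ y generalizing x y
  · exact (this hy hx hfy hfx (le_of_not_ge hxy)).symm
  refine (strictMonoOn_sub_mul_sin ht hx hfx).injOn
    ⟨le_rfl, by linarith [hx.2]⟩ ⟨hxy, by linarith [hx.2, hy.2]⟩ ?_
  linarith

/-- For every `t > 1` there is a unique `x_t ∈ (0,π)` with `x_t = t·sin x_t`, and the map
`Ψ_t(x₀) = x₀ - t·sin x₀` is a strictly increasing continuous bijection from
`[x_t, 2π - x_t]` onto `[0, 2π]`. -/
theorem burgers_characteristic_bijection (t : ℝ) (ht : 1 < t) :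
    (∃! x : ℝ, x ∈ Set.Ioo 0 π ∧ x = t * sin x) ∧
    ∀ xt : ℝ, xt ∈ Set.Ioo 0 π → xt = t * sin xt →
      StrictMonoOn (fun x₀ : ℝ => x₀ - t * sin x₀) (Set.Icc xt (2 * π - xt)) ∧
      ContinuousOn (fun x₀ : ℝ => x₀ - t * sin x₀) (Set.Icc xt (2 * π - xt)) ∧
      Set.BijOn (fun x₀ : ℝ => x₀ - t * sin x₀) (Set.Icc xt (2 * π - xt))
        (Set.Icc 0 (2 * π)) := by
  have h0 : 0 < t := by linarith
  constructor
  · obtain ⟨x, hx, hfx⟩ := exists_eq_mul_sin ht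
    exact ⟨x, ⟨hx, hfx⟩, fun y hy => eq_of_eq_mul_sin h0 hy.1 hx hy.2 hfx⟩
  intro a ha hfix
  have hmono := strictMonoOn_sub_mul_sin h0 ha hfix
  have hcont : ContinuousOn (fun x : ℝ => x - t * sin x) (Set.Icc a (2 * π - a)) := by fun_prop
  have hle : a ≤ 2 * π - a := by linarith [ha.2]
  have hleft : a - t * sin a = 0 := by linarith
  have hright : 2 * π - a - t * sin (2 * π - a) = 2 * π := by
    rw [sin_two_pi_sub]
    linarith
  refine ⟨hmono, hcont, ?_, hmono.injOn, ?_⟩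
  · have h := hmono.monotoneOn.mapsTo_Icc
    simpa only [hleft, hright] using h
  · have h := intermediate_value_Icc hle hcont
    simpa only [Set.SurjOn, hleft, hright] using h
end
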